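/- arXiv:2006.08286 — 2 statements merged into one kernel-verified Lean document; each statement's English description precedes it below -/
import Mathlib

section
/- The free group F₂ on two generators has the R∞ property, i.e., every automorphism of F₂ has infinitely many twisted conjugacy classes. -/
/-- Twisted conjugacy via an endomorphism `α`. -/
def twistedConj {G : Type*} [Group G] (α : G →* G) (x y : G) : Prop :=
  ∃ z : G, x = z * y * (α z)⁻¹

/-- A group has the `R∞` property if every automorphism has infinitely many
twisted conjugacy classes. -/
def RinfinityProperty (G : Type*) [Group G] : Prop :=
  ∀ α : G ≃* G, Infinite (Quot (twistedConj α.toMonoidHom))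


namespace RInf

abbrev F := FreeGroup (Fin 2)
abbrev V := Multiplicative (ℤ × ℤ)
abbrev R := MonoidAlgebra (ZMod 2) V

def a : F := FreeGroup.of 0
def b : F := FreeGroup.of 1

def ab : F →* V := FreeGroup.lift ![Multiplicative.ofAdd (1, 0), Multiplicative.ofAdd (0, 1)]

lemma ab_a : ab a = Multiplicative.ofAdd (1, 0) := by simp [ab, a]
lemma ab_b : ab b = Multiplicative.ofAdd (0, 1) := by simp [ab, b]

noncomputable def chi : F →* R := (MonoidAlgebra.of (ZMod 2) V).comp ab

lemma chi_def (g : F) : chi g = MonoidAlgebra.single (ab g) 1 := rfl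

lemma chi_inv (g : F) : chi g * chi g⁻¹ = 1 := by rw [← map_mul]; simp
lemma chi_inv' (g : F) : chi g⁻¹ * chi g = 1 := by rw [← map_mul]; simp

/-- affine permutation of R -/
noncomputable def aff (g : F) (c : R) : Equiv.Perm R where
  toFun p := chi g * p + c
  invFun p := chi g⁻¹ * (p - c)
  left_inv p := by
    have := chi_inv' g
    simp only [add_sub_cancel_right, ← mul_assoc, this, one_mul]
  right_inv p := by
    have := chi_inv g
    simp only [← mul_assoc, this, one_mul, sub_add_cancel]

noncomputable def rho : F →* Equiv.Perm R := FreeGroup.lift ![aff a 0, aff b 1]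

noncomputable def W (g : F) : R := rho g 0

lemma rho_apply (g : F) : ∀ p, rho g p = chi g * p + W g := by
  have hof : ∀ i : Fin 2, ∀ p, rho (FreeGroup.of i) p = chi (FreeGroup.of i) * p + W (FreeGroup.of i) := by
    intro i p
    fin_cases i
    · simp [W, rho, aff, a]
    · simp [W, rho, aff, b]
  induction g using FreeGroup.induction_on with
  | C1 => intro p; simp [W]
  | of i => exact hof i
  | inv_of i h =>
    intro p
    have h1 : ∀ q, rho (FreeGroup.of i)⁻¹ q = chi (FreeGroup.of i)⁻¹ * (q - W (FreeGroup.of i)) := by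
      intro q
      rw [map_inv, Equiv.Perm.inv_eq_iff_eq, hof, ← mul_assoc, chi_inv]
      ring
    rw [W, h1, h1]; ring
  | mul x y hx hy =>
    intro p
    have : W (x * y) = chi x * W y + W x := by
      rw [W, map_mul, Equiv.Perm.mul_apply, hx]; rfl
    rw [this, map_mul, Equiv.Perm.mul_apply, hx, hy, map_mul]; ring

lemma W_mul (x y : F) : W (x * y) = chi x * W y + W x := by
  rw [W, map_mul, Equiv.Perm.mul_apply, rho_apply]; rfl

lemma W_one : W 1 = 0 := by simp [W]

lemma W_inv (x : F) : W x⁻¹ = - (chi x⁻¹ * W x) := by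
  have := W_mul x⁻¹ x
  rw [inv_mul_cancel, W_one] at this
  linear_combination -this

lemma W_a : W a = 0 := by simp [W, rho, aff, a]
lemma W_b : W b = 1 := by simp [W, rho, aff, b]

/-- the element x - 1 -/
noncomputable def X : R := chi a - 1

lemma X_ne : X ≠ 0 := by
  intro h
  have h2 : chi a = 1 := sub_eq_zero.mp h
  rw [chi_def, ab_a, MonoidAlgebra.one_def] at h2
  have := MonoidAlgebra.single_left_injective (R := ZMod 2) (one_ne_zero) h2
  simp at this

def c : F := a * b * a⁻¹ * b⁻¹

lemma ab_comm (x y : F) : ab (x * y * x⁻¹ * y⁻¹) = 1 := by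
  simp

lemma ab_c : ab c = 1 := ab_comm _ _

lemma chi_of_ab {g : F} (h : ab g = 1) : chi g = 1 := by
  rw [chi_def, h]; rfl

lemma W_c : W c = X := by
  have e : chi (a * b * a⁻¹) * chi b⁻¹ = 1 := by
    rw [← map_mul]; exact chi_of_ab ab_c
  rw [c, W_mul, W_mul (a * b), W_mul a b, W_inv, W_inv, W_a, W_b, X]
  linear_combination -e

lemma W_conj {g n : F} (h : ab n = 1) : W (g * n * g⁻¹) = chi g * W n := by
  rw [W_mul, W_mul g n, W_inv, map_mul, chi_of_ab h]
  have := chi_inv g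
  linear_combination (-W g) * this

def N : Subgroup F := Subgroup.normalClosure {c}

instance : N.Normal := Subgroup.normalClosure_normal

lemma c_mem : c ∈ N := Subgroup.subset_normalClosure rfl

lemma ab_N {n : F} (h : n ∈ N) : ab n = 1 := by
  have : N ≤ ab.ker := Subgroup.normalClosure_le_normal (by
    rintro _ rfl; exact ab_c)
  exact this h

lemma mem_N {n : F} (h : ab n = 1) : n ∈ N := by
  let π : F →* F ⧸ N := QuotientGroup.mk' N
  have hc : Commute (π a) (π b) := by
    have : π c = 1 := (QuotientGroup.eq_one_iff c).mpr c_mem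
    rw [c, map_mul, map_mul, map_mul, map_inv, map_inv] at this
    rw [Commute, SemiconjBy]
    rw [mul_inv_eq_one, mul_inv_eq_iff_eq_mul] at this
    exact this
  let σ : V →* F ⧸ N :=
    { toFun := fun v => π a ^ v.toAdd.1 * π b ^ v.toAdd.2
      map_one' := by simp
      map_mul' := by
        intro x y
        simp only [toAdd_mul, Prod.fst_add, Prod.snd_add, zpow_add]
        have := (hc.zpow_zpow y.toAdd.1 x.toAdd.2).eq
        simp only [mul_assoc]
        congr 1
        rw [← mul_assoc, this, mul_assoc] }
  have : π = σ.comp ab := by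
    apply FreeGroup.ext_hom
    intro i
    fin_cases i
    · change π a = σ (ab a)
      rw [ab_a]; simp [σ]
    · change π b = σ (ab b)
      rw [ab_b]; simp [σ]
  have h2 : π n = 1 := by rw [this]; simp [h]
  exact (QuotientGroup.eq_one_iff n).mp h2

/-- induced map on the abelianization -/
def A (f : F →* F) : V →* V where
  toFun v := ab (f a) ^ v.toAdd.1 * ab (f b) ^ v.toAdd.2
  map_one' := by simp
  map_mul' x y := by
    simp only [toAdd_mul, Prod.fst_add, Prod.snd_add, zpow_add]
    exact mul_mul_mul_comm _ _ _ _

lemma A_ab (f : F →* F) (g : F) : A f (ab g) = ab (f g) := by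
  have : (A f).comp ab = ab.comp f := by
    apply FreeGroup.ext_hom
    intro i
    fin_cases i
    · change A f (ab a) = ab (f a)
      rw [ab_a]; simp [A]
    · change A f (ab b) = ab (f b)
      rw [ab_b]; simp [A]
  exact DFunLike.congr_fun this g

lemma ab_surj (v : V) : ∃ g, ab g = v := by
  refine ⟨a ^ v.toAdd.1 * b ^ v.toAdd.2, ?_⟩
  rw [map_mul, map_zpow, map_zpow, ab_a, ab_b, ← ofAdd_zsmul, ← ofAdd_zsmul, ← ofAdd_add]
  apply Multiplicative.toAdd.injective
  ext <;> simp

lemma A_inv (φ : F ≃* F) (v : V) : A φ.symm.toMonoidHom (A φ.toMonoidHom v) = v := by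
  obtain ⟨g, rfl⟩ := ab_surj v
  rw [A_ab, A_ab]; simp

noncomputable def AR (f : F →* F) : R →+* R := MonoidAlgebra.mapDomainRingHom (ZMod 2) (A f)

lemma AR_chi (f : F →* F) (g : F) : AR f (chi g) = chi (f g) := by
  rw [chi_def, chi_def, ← A_ab, AR]; simp

lemma f_N (f : F →* F) {n : F} (h : ab n = 1) : ab (f n) = 1 := by
  rw [← A_ab, h, map_one]

lemma exists_q {n : F} (h : n ∈ N) : ∃ p, W n = X * p := by
  induction h using Subgroup.closure_induction with
  | mem x hx =>
    rw [Group.mem_conjugatesOfSet_iff] at hx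
    obtain ⟨_, rfl, hx⟩ := hx
    obtain ⟨g, rfl⟩ := isConj_iff.mp hx
    exact ⟨chi g, by rw [W_conj ab_c, W_c, mul_comm]⟩
  | one => exact ⟨0, by simp [W_one]⟩
  | mul x y hx hy h1 h2 =>
    obtain ⟨p, hp⟩ := h1
    obtain ⟨q, hq⟩ := h2
    exact ⟨chi x * q + p, by rw [W_mul, hp, hq]; ring⟩
  | inv x hx h1 =>
    obtain ⟨p, hp⟩ := h1
    exact ⟨-(chi x⁻¹ * p), by rw [W_inv, hp]; ring⟩

lemma exists_q_f (f : F →* F) {U : R} (hU : W (f c) = X * U) {n : F} (h : n ∈ N) :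
    ∃ p, W n = X * p ∧ W (f n) = X * (U * AR f p) := by
  induction h using Subgroup.closure_induction with
  | mem x hx =>
    rw [Group.mem_conjugatesOfSet_iff] at hx
    obtain ⟨_, rfl, hx⟩ := hx
    obtain ⟨g, rfl⟩ := isConj_iff.mp hx
    refine ⟨chi g, by rw [W_conj ab_c, W_c, mul_comm], ?_⟩
    rw [map_mul, map_mul, map_inv, W_conj (f_N f ab_c), hU, AR_chi]; ring
  | one => exact ⟨0, by simp [W_one]⟩
  | mul x y hx hy h1 h2 =>
    obtain ⟨p, hp, hp'⟩ := h1
    obtain ⟨q, hq, hq'⟩ := h2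
    refine ⟨chi x * q + p, by rw [W_mul, hp, hq]; ring, ?_⟩
    rw [map_mul, W_mul, hp', hq', map_add, map_mul, AR_chi]; ring
  | inv x hx h1 =>
    obtain ⟨p, hp, hp'⟩ := h1
    refine ⟨-(chi x⁻¹ * p), by rw [W_inv, hp]; ring, ?_⟩
    rw [map_inv f, W_inv, hp', map_neg, map_mul, AR_chi, map_inv f]; ring

lemma unit_monomial {u w : R} (h : u * w = 1) : ∃ v : V, u = MonoidAlgebra.single v 1 := by
  have hu : u ≠ 0 := by rintro rfl; simp at h
  have hw : w ≠ 0 := by rintro rfl; simp at h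
  have hun : u.coeff.support.Nonempty := by
    rw [Finsupp.support_nonempty_iff]; intro h0; apply hu
    ext x; rw [h0]; rfl
  have hwn : w.coeff.support.Nonempty := by
    rw [Finsupp.support_nonempty_iff]; intro h0; apply hw
    ext x; rw [h0]; rfl
  have key : ∀ x y, x ∈ u.coeff.support → y ∈ w.coeff.support →
      UniqueMul u.coeff.support w.coeff.support x y → x * y = 1 := by
    intro x y hx hy hxy
    have h1 := MonoidAlgebra.coeff_mul_mul_of_uniqueMul hxy
    rw [h] at h1
    by_contra hne
    rw [MonoidAlgebra.one_def] at h1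
    simp only [MonoidAlgebra.coeff_single] at h1
    rw [Finsupp.single_eq_of_ne (by exact hne)] at h1
    rw [Finsupp.mem_support_iff] at hx hy
    exact mul_ne_zero hx hy h1.symm
  have hcard : u.coeff.support.card * w.coeff.support.card ≤ 1 := by
    by_contra hlt
    obtain ⟨p, hp, q, hq, hne, h1, h2⟩ := TwoUniqueProds.uniqueMul_of_one_lt_card (not_le.mp hlt)
    rw [Finset.mem_product] at hp hq
    have e1 := key _ _ hp.1 hp.2 h1
    have e2 := key _ _ hq.1 hq.2 h2
    have := h1 hq.1 hq.2 (e2.trans e1.symm)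
    exact hne (Prod.ext this.1.symm this.2.symm)
  have hc1 : u.coeff.support.card = 1 := by
    have := hun.card_pos
    have := hwn.card_pos
    nlinarith
  obtain ⟨v, hv⟩ := Finset.card_eq_one.mp hc1
  refine ⟨v, ?_⟩
  ext x
  rw [MonoidAlgebra.coeff_single]
  by_cases hx : x = v
  · subst hx
    have : u.coeff x ≠ 0 := by
      rw [← Finsupp.mem_support_iff, hv]; simp
    rw [Finsupp.single_eq_same]
    revert this
    generalize u.coeff x = t
    revert t
    decide
  · rw [Finsupp.single_eq_of_ne hx]
    rw [← Finsupp.notMem_support_iff, hv]; simpa using hx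

/-- content of an integer vector -/
def cont (v : V) : ℕ := Int.gcd v.toAdd.1 v.toAdd.2

lemma cont_dvd (B : V →* V) (v : V) : cont v ∣ cont (B v) := by
  obtain ⟨m, hm⟩ := Int.gcd_dvd_left v.toAdd.1 v.toAdd.2
  obtain ⟨n, hn⟩ := Int.gcd_dvd_right v.toAdd.1 v.toAdd.2
  have : v = (Multiplicative.ofAdd (m, n)) ^ (cont v : ℤ) := by
    apply Multiplicative.toAdd.injective
    ext
    · simp only [toAdd_zpow, toAdd_ofAdd, Prod.smul_fst, smul_eq_mul]; exact hm
    · simp only [toAdd_zpow, toAdd_ofAdd, Prod.smul_snd, smul_eq_mul]; exact hn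
  have h2 := congrArg B this
  rw [map_zpow] at h2
  generalize B (Multiplicative.ofAdd (m, n)) = t at h2
  rw [h2]
  conv_rhs => unfold cont
  rw [Int.gcd_eq_natAbs_gcd_natAbs]
  apply Nat.dvd_gcd
  · rw [toAdd_zpow, Prod.smul_fst, smul_eq_mul, Int.natAbs_mul, Int.natAbs_natCast]
    exact dvd_mul_right _ _
  · rw [toAdd_zpow, Prod.smul_snd, smul_eq_mul, Int.natAbs_mul, Int.natAbs_natCast]
    exact dvd_mul_right _ _

lemma cont_A (φ : F ≃* F) (v : V) : cont (A φ.toMonoidHom v) = cont v :=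
  Nat.dvd_antisymm (by simpa only [A_inv] using cont_dvd (A φ.symm.toMonoidHom) (A φ.toMonoidHom v))
    (cont_dvd _ _)

lemma cont_zpow (v : V) (n : ℤ) : cont (v ^ n) = n.natAbs * cont v := by
  simp [cont, Int.gcd_mul_left]

lemma cont_ne {v : V} (h : v ≠ 1) : cont v ≠ 0 := by
  intro h0
  apply h
  rw [cont, Int.gcd_eq_zero_iff] at h0
  apply Multiplicative.toAdd.injective
  exact Prod.ext h0.1 h0.2

lemma dichotomy (f : F →* F) :
    (∃ l1 l2 : ℤ, (l1 ≠ 0 ∨ l2 ≠ 0) ∧ ∀ v : V, l1 * (A f v).toAdd.1 + l2 * (A f v).toAdd.2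
      = l1 * v.toAdd.1 + l2 * v.toAdd.2) ∨
    (∃ d : ℤ, d ≠ 0 ∧ (∀ v, A f v = v → v = 1) ∧ ∀ u, ∃ w, A f w * w⁻¹ = u ^ d) := by
  obtain ⟨p, hp⟩ : ∃ p, p = (ab (f a)).toAdd.1 := ⟨_, rfl⟩
  obtain ⟨q, hq⟩ : ∃ p, p = (ab (f a)).toAdd.2 := ⟨_, rfl⟩
  obtain ⟨r, hr⟩ : ∃ p, p = (ab (f b)).toAdd.1 := ⟨_, rfl⟩
  obtain ⟨s, hs⟩ : ∃ p, p = (ab (f b)).toAdd.2 := ⟨_, rfl⟩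
  have h1 : ∀ v, (A f v).toAdd.1 = v.toAdd.1 * p + v.toAdd.2 * r := by
    intro v; simp [A, hp, hr]
  have h2 : ∀ v, (A f v).toAdd.2 = v.toAdd.1 * q + v.toAdd.2 * s := by
    intro v; simp [A, hq, hs]
  by_cases hd : (p - 1) * (s - 1) - q * r = 0
  · left
    simp only [h1, h2]
    by_cases hA : q = 0 ∧ 1 - p = 0
    · by_cases hB : s - 1 = 0 ∧ r = 0
      · refine ⟨1, 0, by simp, fun v => ?_⟩
        linear_combination (-v.toAdd.1) * hA.2 + v.toAdd.2 * hB.2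
      · refine ⟨s - 1, -r, ?_, fun v => ?_⟩
        · by_contra hh; push Not at hh; exact hB ⟨hh.1, by linarith [hh.2]⟩
        · linear_combination v.toAdd.1 * hd
    · refine ⟨q, 1 - p, ?_, fun v => ?_⟩
      · by_contra hh; push Not at hh; exact hA hh
      · linear_combination -v.toAdd.2 * hd
  · right
    refine ⟨_, hd, fun v hv => ?_, fun u => ?_⟩
    · have e1 := h1 v
      have e2 := h2 v
      rw [hv] at e1 e2
      apply Multiplicative.toAdd.injective
      ext
      · have : ((p - 1) * (s - 1) - q * r) * v.toAdd.1 = 0 := by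
          linear_combination -(s - 1) * e1 + r * e2
        simpa [hd] using this
      · have : ((p - 1) * (s - 1) - q * r) * v.toAdd.2 = 0 := by
          linear_combination q * e1 - (p - 1) * e2
        simpa [hd] using this
    · refine ⟨Multiplicative.ofAdd ((s - 1) * u.toAdd.1 - r * u.toAdd.2,
        -q * u.toAdd.1 + (p - 1) * u.toAdd.2), ?_⟩
      apply Multiplicative.toAdd.injective
      ext
      · rw [toAdd_mul, Prod.fst_add, h1]; simp; ring
      · rw [toAdd_mul, Prod.snd_add, h2]; simp; ring

lemma infinite_of {G : Type*} [Group G] (f : G →* G) (x : ℕ → G)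
    (h : ∀ m n, twistedConj f (x m) (x n) → m = n) : Infinite (Quot (twistedConj f)) := by
  have heq : Equivalence (twistedConj f) := by
    refine ⟨fun x => ⟨1, by simp⟩, ?_, ?_⟩
    · rintro x y ⟨z, rfl⟩
      exact ⟨z⁻¹, by simp [mul_assoc]⟩
    · rintro x y w ⟨z, rfl⟩ ⟨t, rfl⟩
      exact ⟨z * t, by simp [mul_assoc]⟩
  refine Infinite.of_injective (fun n => Quot.mk _ (x n)) fun m n hmn => h m n ?_
  have := Quot.eqvGen_exact hmn
  rwa [heq.eqvGen_iff] at this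

lemma case_one (φ : F ≃* F) (l1 l2 : ℤ) (hl : l1 ≠ 0 ∨ l2 ≠ 0)
    (h : ∀ v : V, l1 * (A φ.toMonoidHom v).toAdd.1 + l2 * (A φ.toMonoidHom v).toAdd.2
      = l1 * v.toAdd.1 + l2 * v.toAdd.2) : Infinite (Quot (twistedConj φ.toMonoidHom)) := by
  obtain ⟨g, hg⟩ := ab_surj (Multiplicative.ofAdd (l1, l2))
  refine infinite_of _ (fun n => g ^ n) ?_
  rintro m n ⟨z, hz⟩
  have hz2 := congrArg ab hz
  simp only [map_mul, map_inv, map_pow, ← A_ab, hg] at hz2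
  have e := h (ab z)
  generalize A φ.toMonoidHom (ab z) = t at hz2 e
  have e1 := congrArg (fun v : V => v.toAdd.1) hz2
  have e2 := congrArg (fun v : V => v.toAdd.2) hz2
  simp at e1 e2
  have : (l1 ^ 2 + l2 ^ 2) * ((m : ℤ) - n) = 0 := by
    linear_combination l1 * e1 + l2 * e2 - e
  rcases mul_eq_zero.mp this with h0 | h0
  · exfalso
    rcases hl with hl | hl
    · have := pow_pos (abs_pos.mpr hl) 2
      rw [sq_abs] at this
      nlinarith [sq_nonneg l2]
    · have := pow_pos (abs_pos.mpr hl) 2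
      rw [sq_abs] at this
      nlinarith [sq_nonneg l1]
  · omega

lemma case_two (φ : F ≃* F) (d : ℤ) (hd : d ≠ 0) (hfix : ∀ v, A φ.toMonoidHom v = v → v = 1)
    (hsol : ∀ u, ∃ w, A φ.toMonoidHom w * w⁻¹ = u ^ d) :
    Infinite (Quot (twistedConj φ.toMonoidHom)) := by
  set f := φ.toMonoidHom with hf
  obtain ⟨U, hU⟩ := exists_q (mem_N (f_N f ab_c))
  obtain ⟨v, hv⟩ : ∃ v : V, U = MonoidAlgebra.single v 1 := by
    obtain ⟨p, -, hp⟩ := exists_q_f f hU (n := φ.symm c) (mem_N (f_N φ.symm.toMonoidHom ab_c))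
    have : f (φ.symm c) = c := by simp [hf]
    rw [this, W_c] at hp
    refine unit_monomial (w := AR f p) ?_
    apply mul_left_cancel₀ X_ne
    rw [← hp, mul_one]
  let κ : V → V := fun w => A f w * v * w⁻¹
  have hκ : ∀ w, κ (v * A f w) = A f (κ w) := by
    intro w
    simp only [κ, map_mul, map_inv, mul_inv]
    rw [mul_comm v⁻¹, mul_assoc, mul_assoc, mul_left_comm v, mul_inv_cancel, mul_one, mul_comm (A f v)]
    rw [mul_assoc, mul_assoc, mul_comm (A f v)]
  let L : R →+ MonoidAlgebra (ZMod 2) ℕ := 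
    (MonoidAlgebra.mapDomainLinearMap (ZMod 2) (ZMod 2) (fun w => cont (κ w))).toAddMonoidHom
  have hL1 : ∀ w t, L (MonoidAlgebra.single w t) = MonoidAlgebra.single (cont (κ w)) t := by
    intro w t
    simp [L]
  have hL : ∀ p, L (U * AR f p) = L p := by
    intro p
    have : (L.comp ((AddMonoidHom.mulLeft U).comp (AR f : R →+ R))) = L := by
      refine MonoidAlgebra.addMonoidHom_ext fun w t => ?_
      have e : AR f (MonoidAlgebra.single w t) = MonoidAlgebra.single (A f w) t := by
        simp [AR]
      change L (U * AR f (MonoidAlgebra.single w t)) = _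
      rw [e, hv, MonoidAlgebra.single_mul_single, one_mul, hL1, hL1, hκ, hf, cont_A]
    exact DFunLike.congr_fun this p
  obtain ⟨w0, hw0⟩ : ∃ w0, κ w0 ≠ 1 := by
    by_contra hcon
    push Not at hcon
    have h1 := hcon 1
    have h2 := hcon (Multiplicative.ofAdd (1, 0))
    simp only [κ, map_one, one_mul, inv_one, mul_one] at h1 h2
    rw [h1, mul_one, mul_inv_eq_one] at h2
    have := hfix _ h2
    simp at this
  obtain ⟨w1, hw1⟩ := hsol (κ w0 ^ d)
  have hp : ∀ n : ℕ, cont (κ (w0 * w1 ^ n)) = (n * d.natAbs ^ 2 + 1) * cont (κ w0) := by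
    intro n
    have : κ (w0 * w1 ^ n) = κ w0 ^ ((n : ℤ) * d ^ 2 + 1) := by
      have : κ (w0 * w1 ^ n) = κ w0 * (A f w1 * w1⁻¹) ^ n := by
        simp only [κ, map_mul, map_pow, mul_inv, mul_pow, inv_pow]
        simp only [mul_assoc, mul_comm, mul_left_comm]
      rw [this, hw1, zpow_add_one, mul_comm, ← zpow_mul, ← zpow_natCast, ← zpow_mul]
      congr 2
      ring
    rw [this, cont_zpow]
    congr 1
    zify
    rw [abs_of_nonneg (by positivity), sq_abs]
  choose g hg using ab_surj
  have hW : ∀ w, W (g w * c * (g w)⁻¹) = X * MonoidAlgebra.single w 1 := by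
    intro w
    rw [W_conj ab_c, W_c, chi_def, hg, mul_comm]
  have hab : ∀ h, ab (h * c * h⁻¹) = 1 := by
    intro h; simp [ab_c]
  refine infinite_of _ (fun n => g (w0 * w1 ^ n) * c * (g (w0 * w1 ^ n))⁻¹) ?_
  rintro m n ⟨z, hz⟩
  have hz1 : ab z = 1 := by
    have h1 := congrArg ab hz
    simp only [map_mul ab _ (f z)⁻¹, map_mul ab z, hab, map_inv ab (f z), ← A_ab] at h1
    rw [mul_one, eq_comm, mul_inv_eq_one] at h1
    exact hfix _ h1.symm
  obtain ⟨p, hp1, hp2⟩ := exists_q_f f hU (mem_N hz1)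
  have hfz : ab (f z) = 1 := f_N f hz1
  have h2 := congrArg W hz
  rw [hW, W_mul _ (f z)⁻¹, W_mul z, W_inv, hW, map_mul, chi_of_ab hz1, chi_of_ab (hab _), chi_of_ab (g := (f z)⁻¹) (by rw [map_inv, hfz, inv_one]),
    hp1, hp2] at h2
  have h3 : (MonoidAlgebra.single (w0 * w1 ^ m) 1 : R) 
      = MonoidAlgebra.single (w0 * w1 ^ n) 1 + p - U * AR f p := by
    apply mul_left_cancel₀ X_ne
    linear_combination h2
  have h4 := congrArg L h3
  rw [map_sub, map_add, hL, add_sub_cancel_right, hL1, hL1] at h4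
  have h5 := MonoidAlgebra.single_left_injective (R := ZMod 2) (one_ne_zero) h4
  rw [hp, hp] at h5
  have h6 := Nat.eq_of_mul_eq_mul_right (Nat.pos_of_ne_zero (cont_ne hw0)) h5
  have h7 := Nat.eq_of_mul_eq_mul_right (pow_pos (Int.natAbs_pos.mpr hd) 2) (Nat.succ_injective h6)
  exact h7

end RInf

theorem freeGroup_two_Rinfinity : RinfinityProperty (FreeGroup (Fin 2)) := by
  intro φ
  rcases RInf.dichotomy φ.toMonoidHom with ⟨l1, l2, hl, h⟩ | ⟨d, hd, h1, h2⟩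
  · exact RInf.case_one φ l1 l2 hl h
  · exact RInf.case_two φ d hd h1 h2
end

section
/- If G = H × ℤ where Z(G) = ℤ (the second factor is the center of G) and H has the R∞ property and trivial center, then G has the R∞ property. In particular, since P₃ ≅ F₂ × ℤ with ℤ = Z(P₃), the pure braid group P₃ has the R∞ property. -/
namespace P3

open scoped commutatorElement

lemma tc_equiv {G : Type*} [Group G] (α : G →* G) : Equivalence (twistedConj α) where
  refl x := ⟨1, by simp⟩
  symm := by
    rintro x y ⟨z, rfl⟩
    exact ⟨z⁻¹, by simp [mul_assoc]⟩
  trans := by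
    rintro x y w ⟨z, rfl⟩ ⟨z', rfl⟩
    exact ⟨z * z', by simp [mul_assoc]⟩

lemma tc_exact {G : Type*} [Group G] (α : G →* G) {x y : G}
    (h : Quot.mk (twistedConj α) x = Quot.mk (twistedConj α) y) : twistedConj α x y :=
  ((tc_equiv α).eqvGen_iff).1 (Quot.eqvGen_exact h)

/-- Pushing twisted conjugacy classes forward along a surjection. -/
lemma infinite_of_surj {G H : Type*} [Group G] [Group H] (π : G →* H)
    (hπ : Function.Surjective π) (α : G →* G) (β : H →* H) (h : ∀ g, π (α g) = β (π g))
    (hH : Infinite (Quot (twistedConj β))) : Infinite (Quot (twistedConj α)) := by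
  let F : Quot (twistedConj α) → Quot (twistedConj β) :=
    Quot.map π (by
      rintro x y ⟨z, rfl⟩
      exact ⟨π z, by simp [h]⟩)
  refine Infinite.of_surjective F ?_
  rintro ⟨y⟩
  obtain ⟨x, rfl⟩ := hπ y
  exact ⟨Quot.mk _ x, rfl⟩

lemma Rinf_of_equiv {G H : Type*} [Group G] [Group H] (e : G ≃* H) (hH : RinfinityProperty H) :
    RinfinityProperty G := by
  intro α
  refine infinite_of_surj e.toMonoidHom e.surjective _ ((e.symm.trans α).trans e).toMonoidHom ?_
    (hH _)
  intro g
  simp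

lemma fst_center {H : Type*} [Group H] (hc : Subgroup.center H = ⊥)
    (α : (H × Multiplicative ℤ) ≃* (H × Multiplicative ℤ)) (k : Multiplicative ℤ) :
    (α (1, k)).1 = 1 := by
  have : (α (1, k)).1 ∈ Subgroup.center H := by
    rw [Subgroup.mem_center_iff]
    intro g
    have h1 : α.symm (g, 1) * (1, k) = (1, k) * α.symm (g, 1) := by
      ext
      · simp
      · simp [mul_comm]
    have h2 := congrArg (fun t => (α t).1) h1
    simpa using h2
  rw [hc] at this
  simpa using this

lemma fst_apply {H : Type*} [Group H] (hc : Subgroup.center H = ⊥)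
    (α : (H × Multiplicative ℤ) ≃* (H × Multiplicative ℤ)) (g : H × Multiplicative ℤ) :
    (α (g.1, 1)).1 = (α g).1 := by
  have : g = (g.1, 1) * (1, g.2) := by ext <;> simp
  conv_rhs => rw [this, map_mul, Prod.fst_mul, fst_center hc, mul_one]

lemma part1 {H : Type*} [Group H] (hH : RinfinityProperty H) (hc : Subgroup.center H = ⊥) :
    RinfinityProperty (H × Multiplicative ℤ) := by
  intro α
  let β : H ≃* H :=
    { toFun := fun h => (α (h, 1)).1
      invFun := fun h => (α.symm (h, 1)).1
      left_inv := fun h => by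
        change (α.symm ((α (h, 1)).1, 1)).1 = h
        rw [fst_apply hc]; simp
      right_inv := fun h => by
        change (α ((α.symm (h, 1)).1, 1)).1 = h
        rw [fst_apply hc]; simp
      map_mul' := fun a b => by
        rw [← Prod.fst_mul, ← map_mul]; simp }
  refine infinite_of_surj (MonoidHom.fst H (Multiplicative ℤ)) Prod.fst_surjective _
    β.toMonoidHom ?_ (hH β)
  intro g
  exact (fst_apply hc α g).symm

abbrev F := FreeGroup (Fin 2)

lemma center_free : Subgroup.center F = ⊥ := by
  rw [eq_bot_iff]
  intro z hz
  rw [Subgroup.mem_center_iff] at hz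
  by_contra hne
  have hne' : z.toWord ≠ [] := by
    intro h
    exact hne (FreeGroup.toWord_eq_nil_iff.1 h)
  have hr : FreeGroup.IsReduced z.toWord := FreeGroup.isReduced_toWord
  set L := z.toWord with hL
  let s : Fin 2 × Bool := (1 - (L.head hne').1, (L.getLast hne').2)
  have hs : s.1 ≠ (L.head hne').1 := by
    change 1 - (L.head hne').1 ≠ (L.head hne').1
    generalize (L.head hne').1 = i
    revert i; decide
  have h1 : FreeGroup.IsReduced (s :: L) := by
    unfold FreeGroup.IsReduced at hr ⊢
    rw [List.isChain_cons]
    refine ⟨?_, hr⟩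
    intro y hy h
    rw [List.head?_eq_some_head hne'] at hy
    simp only [Option.mem_def, Option.some.injEq] at hy
    subst hy
    exact absurd h hs
  have h2 : FreeGroup.IsReduced (L ++ [s]) := by
    unfold FreeGroup.IsReduced at hr ⊢
    rw [List.isChain_append]
    refine ⟨hr, by simp, ?_⟩
    intro x hx y hy h
    rw [List.getLast?_eq_some_getLast hne'] at hx
    simp only [Option.mem_def, Option.some.injEq, List.head?_cons] at hx hy
    subst hx hy
    rfl
  have h3 := congrArg FreeGroup.toWord (hz (FreeGroup.mk [s]))
  have h0 : FreeGroup.mk L = z := FreeGroup.mk_toWord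
  rw [← h0, FreeGroup.mul_mk, FreeGroup.mul_mk, FreeGroup.toWord_mk, FreeGroup.toWord_mk] at h3
  rw [h2.reduce_eq] at h3
  have h4 : ([s] ++ L) = s :: L := rfl
  rw [h4, h1.reduce_eq] at h3
  apply hs
  have h5 := congrArg List.head? h3
  rw [List.head?_append_of_ne_nil _ hne', List.head?_eq_some_head hne'] at h5
  simp only [List.head?_cons, Option.some.injEq] at h5
  rw [← h5]

abbrev V := Abelianization F
abbrev R := MonoidAlgebra (ZMod 2) V

noncomputable def x : F := FreeGroup.of 0
noncomputable def y : F := FreeGroup.of 1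

/-- The map to `ℤ²` as an injective hom. -/
noncomputable def K : V →* Multiplicative (Fin 2 →₀ ℤ) :=
  AddMonoidHom.toMultiplicativeRight
    ((FreeAbelianGroup.equivFinsupp (Fin 2)).toAddMonoidHom : Additive V →+ (Fin 2 →₀ ℤ))

lemma K_inj : Function.Injective K := by
  intro a b h
  exact (FreeAbelianGroup.equivFinsupp (Fin 2)).injective h

lemma K_of (i : Fin 2) : K (Abelianization.of (FreeGroup.of i)) =
    Multiplicative.ofAdd (Finsupp.single i 1) := by
  change Multiplicative.ofAdd (FreeAbelianGroup.toFinsupp (FreeAbelianGroup.of i)) = _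
  rw [FreeAbelianGroup.toFinsupp_of]

instance : TwoUniqueProds V :=
  TwoUniqueProds.of_injective_mulHom K.toMulHom K_inj inferInstance

lemma unit_monomial (J J' : R) (h : J * J' = 1) : ∃ v : V, J = MonoidAlgebra.of (ZMod 2) V v := by
  classical
  have key : ∀ a ∈ J.coeff.support, ∀ b ∈ J'.coeff.support,
      UniqueMul J.coeff.support J'.coeff.support a b → a * b = 1 := by
    intro a ha b hb hu
    by_contra hab
    have h1 := MonoidAlgebra.coeff_mul_mul_of_uniqueMul hu
    rw [h, MonoidAlgebra.one_def] at h1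
    rw [MonoidAlgebra.coeff_single, Finsupp.single_apply, if_neg (Ne.symm hab)] at h1
    rcases mul_eq_zero.1 h1.symm with h2 | h2
    · exact (Finsupp.mem_support_iff.1 ha) h2
    · exact (Finsupp.mem_support_iff.1 hb) h2
  have hcard : J.coeff.support.card * J'.coeff.support.card ≤ 1 := by
    by_contra hc
    obtain ⟨p, hp, q, hq, hpq, h1, h2⟩ := TwoUniqueProds.uniqueMul_of_one_lt_card (not_le.1 hc)
    rw [Finset.mem_product] at hp hq
    have e1 := key _ hp.1 _ hp.2 h1
    have e2 := key _ hq.1 _ hq.2 h2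
    have := h1 hq.1 hq.2 (e2.trans e1.symm)
    exact hpq (Prod.ext this.1.symm this.2.symm)
  have hJ : J.coeff.support.card ≠ 0 := by
    intro h0
    rw [Finset.card_eq_zero, Finsupp.support_eq_empty, MonoidAlgebra.coeff_eq_zero] at h0
    rw [h0, zero_mul] at h
    exact zero_ne_one h
  have hJ' : J'.coeff.support.card ≠ 0 := by
    intro h0
    rw [Finset.card_eq_zero, Finsupp.support_eq_empty, MonoidAlgebra.coeff_eq_zero] at h0
    rw [h0, mul_zero] at h
    exact zero_ne_one h
  have h1 : J.coeff.support.card = 1 := by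
    have := Nat.pos_of_ne_zero hJ
    have := Nat.pos_of_ne_zero hJ'
    nlinarith
  rw [Finsupp.card_support_eq_one] at h1
  obtain ⟨v, hv, hv'⟩ := h1
  refine ⟨v, ?_⟩
  have h2 : ∀ t : ZMod 2, t ≠ 0 → t = 1 := by decide
  rw [h2 _ hv] at hv'
  ext w
  rw [hv']
  simp [MonoidAlgebra.of_apply]


/-- The image of a word in the group ring of the abelianization. -/
noncomputable def e : F →* R := (MonoidAlgebra.of (ZMod 2) V).comp Abelianization.of

lemma e_inv_mul (w : F) : e w⁻¹ * e w = 1 := by rw [← map_mul]; simp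

lemma e_mul_inv (w : F) : e w * e w⁻¹ = 1 := by rw [← map_mul]; simp

/-- The affine map `r ↦ e g * r + b`. -/
noncomputable def aff (g : F) (b : R) : Equiv.Perm R where
  toFun r := e g * r + b
  invFun r := e g⁻¹ * (r - b)
  left_inv r := by linear_combination r * e_inv_mul g
  right_inv r := by linear_combination (r - b) * e_mul_inv g

/-- Affine representation giving Fox derivatives. -/
noncomputable def rho (i : Fin 2) : F →* Equiv.Perm R :=
  FreeGroup.lift (fun j => aff (FreeGroup.of j) (if i = j then 1 else 0))

/-- Fox derivative. -/
noncomputable def d (i : Fin 2) (w : F) : R := rho i w 0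

lemma rho_apply (i : Fin 2) (w : F) : ∀ r, rho i w r = e w * r + d i w := by
  induction w using FreeGroup.induction_on with
  | C1 => intro r; simp [d]
  | of j => intro r; simp [d, rho, aff]
  | inv_of j _ =>
    intro r
    simp only [d, rho, map_inv, FreeGroup.lift_apply_of]
    change e (FreeGroup.of j)⁻¹ * (r - _) = _ * r + e (FreeGroup.of j)⁻¹ * (0 - _)
    rw [show (e (FreeGroup.of j)⁻¹) = e (FreeGroup.of j)⁻¹ from rfl]
    ring
  | mul u v hu hv =>
    intro r
    have : d i (u * v) = e u * d i v + d i u := by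
      simp only [d, map_mul, Equiv.Perm.mul_apply]
      rw [hu]; rfl
    rw [this, map_mul, map_mul, Equiv.Perm.mul_apply, hu, hv]
    ring

lemma d_mul (i : Fin 2) (u v : F) : d i (u * v) = d i u + e u * d i v := by
  have : d i (u * v) = rho i u (d i v) := by simp [d]
  rw [this, rho_apply]; ring

lemma d_of (i j : Fin 2) : d i (FreeGroup.of j) = if i = j then 1 else 0 := by
  simp [d, rho, aff]

lemma cross_ext (τ : F →* R) (D D' : F → R) (h1 : ∀ u v, D (u * v) = D u + τ u * D v)
    (h2 : ∀ u v, D' (u * v) = D' u + τ u * D' v)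
    (h : ∀ j, D (FreeGroup.of j) = D' (FreeGroup.of j)) (w : F) : D w = D' w := by
  have o1 : D 1 = 0 := by simpa using h1 1 1
  have o2 : D' 1 = 0 := by simpa using h2 1 1
  induction w using FreeGroup.induction_on with
  | C1 => rw [o1, o2]
  | of j => exact h j
  | inv_of j _ =>
    have a1 := h1 (FreeGroup.of j)⁻¹ (FreeGroup.of j)
    have a2 := h2 (FreeGroup.of j)⁻¹ (FreeGroup.of j)
    rw [inv_mul_cancel, o1] at a1
    rw [inv_mul_cancel, o2, ← h j] at a2
    linear_combination a2 - a1
  | mul u v hu hv => rw [h1, h2, hu, hv]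

lemma fundamental (w : F) : e w - 1 = d 0 w * (e x - 1) + d 1 w * (e y - 1) := by
  refine cross_ext e (fun w => e w - 1) (fun w => d 0 w * (e x - 1) + d 1 w * (e y - 1))
    ?_ ?_ ?_ w
  · intro u v; simp only [map_mul]; ring
  · intro u v; simp only [d_mul]; ring
  · intro j
    fin_cases j <;> simp [d_of, x, y]

/-- The ring endomorphism induced by an endomorphism of the free group. -/
noncomputable def A (α : F →* F) : R →+* R :=
  MonoidAlgebra.mapDomainRingHom (ZMod 2) (Abelianization.map α)

lemma A_e (α : F →* F) (w : F) : A α (e w) = e (α w) := by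
  simp [A, e]

lemma chain (α : F →* F) (i : Fin 2) (w : F) :
    d i (α w) = A α (d 0 w) * d i (α x) + A α (d 1 w) * d i (α y) := by
  refine cross_ext (e.comp α) (fun w => d i (α w))
    (fun w => A α (d 0 w) * d i (α x) + A α (d 1 w) * d i (α y)) ?_ ?_ ?_ w
  · intro u v; simp only [map_mul, d_mul]; rfl
  · intro u v; simp only [map_add, map_mul, d_mul, A_e, MonoidHom.comp_apply]; ring
  · intro j
    fin_cases j <;> simp [d_of, x, y]

/-- `p` is the class of `w` in the (rank one) Alexander module. -/
def IsP (w : F) (p : R) : Prop := d 0 w = p * (1 - e y) ∧ d 1 w = p * (e x - 1)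

lemma e_comm {w : F} (hw : w ∈ commutator F) : e w = 1 := by
  rw [← Abelianization.ker_of, MonoidHom.mem_ker] at hw
  rw [e, MonoidHom.comp_apply, hw, map_one]

lemma d_one (i : Fin 2) : d i 1 = 0 := by simp [d]

lemma d_inv (i : Fin 2) (w : F) : d i w⁻¹ = - (e w⁻¹ * d i w) := by
  have := d_mul i w⁻¹ w
  rw [inv_mul_cancel, d_one] at this
  linear_combination -this

lemma IsP.mul {u v : F} {p q : R} (hu : IsP u p) (hv : IsP v q) (h : e u = 1) :
    IsP (u * v) (p + q) := by
  constructor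
  · rw [d_mul, hu.1, hv.1, h]; ring
  · rw [d_mul, hu.2, hv.2, h]; ring

lemma IsP.inv {u : F} {p : R} (hu : IsP u p) (h : e u = 1) : IsP u⁻¹ (-p) := by
  have h' : e u⁻¹ = 1 := by simpa [h] using e_inv_mul u
  constructor
  · rw [d_inv, hu.1, h']; ring
  · rw [d_inv, hu.2, h']; ring

lemma IsP.conj {u : F} {p : R} (hu : IsP u p) (h : e u = 1) (g : F) :
    IsP (g * u * g⁻¹) (e g * p) := by
  constructor
  · rw [d_mul, d_mul, d_inv, hu.1, map_mul, h]
    linear_combination - d 0 g * e_mul_inv g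
  · rw [d_mul, d_mul, d_inv, hu.2, map_mul, h]
    linear_combination - d 1 g * e_mul_inv g

lemma isP_comm (u v : F) : IsP ⁅u, v⁆ (d 0 u * d 1 v - d 1 u * d 0 v) := by
  have hc : e ⁅u, v⁆ = 1 :=
    e_comm (Subgroup.commutator_mem_commutator (Subgroup.mem_top u) (Subgroup.mem_top v))
  have hd : ∀ i, d i ⁅u, v⁆ = d i (u * v) - d i (v * u) := by
    intro i
    have h1 : u * v = ⁅u, v⁆ * (v * u) := by simp [commutatorElement_def, mul_assoc]
    have h2 := d_mul i ⁅u, v⁆ (v * u)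
    rw [← h1, hc] at h2
    linear_combination - h2
  have fu := fundamental u
  have fv := fundamental v
  constructor
  · rw [hd, d_mul, d_mul]
    linear_combination d 0 v * fu - d 0 u * fv
  · rw [hd, d_mul, d_mul]
    linear_combination d 1 v * fu - d 1 u * fv

lemma exists_isP {w : F} (hw : w ∈ commutator F) : ∃ p, IsP w p := by
  have hw' := hw
  rw [commutator_eq_closure] at hw'
  induction hw' using Subgroup.closure_induction with
  | mem w h =>
    obtain ⟨u, v, rfl⟩ := h
    exact ⟨_, isP_comm u v⟩
  | one => exact ⟨0, by simp [IsP, d_one]⟩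
  | mul u v hu hv h1 h2 =>
    rw [← commutator_eq_closure] at hu hv
    obtain ⟨p, hp⟩ := h1 hu
    obtain ⟨q, hq⟩ := h2 hv
    exact ⟨_, hp.mul hq (e_comm hu)⟩
  | inv u hu h1 =>
    rw [← commutator_eq_closure] at hu
    obtain ⟨p, hp⟩ := h1 hu
    exact ⟨_, hp.inv (e_comm hu)⟩

lemma y_ne : (1 : R) - e y ≠ 0 := by
  intro h
  have h1 : e 1 = e y := by rw [map_one]; exact sub_eq_zero.1 h
  have h2 := MonoidAlgebra.of_injective (R := ZMod 2) h1
  have h3 := congrArg K h2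
  rw [y, K_of] at h3
  have h4 := DFunLike.congr_fun (congrArg Multiplicative.toAdd h3) 1
  simp at h4

lemma IsP.unique {w : F} {p q : R} (hp : IsP w p) (hq : IsP w q) : p = q :=
  mul_right_cancel₀ y_ne (hp.1.symm.trans hq.1)

/-- Jacobian. -/
noncomputable def Jac (α : F →* F) : R := d 0 (α x) * d 1 (α y) - d 1 (α x) * d 0 (α y)

lemma IsP.map {w : F} {p : R} (hp : IsP w p) (α : F →* F) : IsP (α w) (A α p * Jac α) := by
  have fu := fundamental (α x)
  have fv := fundamental (α y)
  constructor
  · rw [chain, hp.1, hp.2]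
    simp only [map_mul, map_sub, map_one, A_e, Jac]
    linear_combination A α p * (d 0 (α y) * fu - d 0 (α x) * fv)
  · rw [chain, hp.1, hp.2]
    simp only [map_mul, map_sub, map_one, A_e, Jac]
    linear_combination A α p * (d 1 (α y) * fu - d 1 (α x) * fv)

lemma isP_c : IsP ⁅x, y⁆ 1 := by
  have := isP_comm x y
  simpa [x, y, d_of] using this

lemma c_mem : ⁅x, y⁆ ∈ commutator F :=
  Subgroup.commutator_mem_commutator (Subgroup.mem_top x) (Subgroup.mem_top y)

lemma map_comm_mem (α : F →* F) {w : F} (hw : w ∈ commutator F) : α w ∈ commutator F := by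
  rw [← Abelianization.ker_of, MonoidHom.mem_ker] at hw ⊢
  rw [← Abelianization.map_of, hw, map_one]

lemma Jac_unit (α : F ≃* F) : ∃ g : F, e g * Jac α.toMonoidHom = 1 := by
  obtain ⟨p, hp⟩ := exists_isP (map_comm_mem α.symm.toMonoidHom c_mem)
  have h := hp.map α.toMonoidHom
  have h1 : α.toMonoidHom (α.symm.toMonoidHom ⁅x, y⁆) = ⁅x, y⁆ := α.apply_symm_apply _
  rw [h1] at h
  have h2 := h.unique isP_c
  obtain ⟨v, hv⟩ := unit_monomial (Jac α.toMonoidHom) (A α.toMonoidHom p) (by rw [mul_comm, h2])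
  obtain ⟨g, rfl⟩ := QuotientGroup.mk'_surjective _ v
  refine ⟨g⁻¹, ?_⟩
  rw [hv]
  exact e_inv_mul g

/-- Set of natural numbers `k` such that `v` is a `k`-th power. -/
def content (v : V) : Set ℕ := {k | ∃ u, u ^ k = v}

lemma content_map (a : V ≃* V) (v : V) : content (a v) = content v := by
  ext k
  constructor
  · rintro ⟨u, hu⟩
    exact ⟨a.symm u, by rw [← map_pow, hu, a.symm_apply_apply]⟩
  · rintro ⟨u, hu⟩
    exact ⟨a u, by rw [← map_pow, hu]⟩

lemma content_pow (n : ℕ) : content (Abelianization.of x ^ n) = {k | k ∣ n} := by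
  ext k
  constructor
  · rintro ⟨u, hu⟩
    have h3 := congrArg K hu
    rw [x, map_pow, map_pow, K_of] at h3
    have h4 := DFunLike.congr_fun (congrArg Multiplicative.toAdd h3) 0
    simp only [toAdd_pow, toAdd_ofAdd, Finsupp.smul_apply, Finsupp.single_eq_same] at h4
    have : (k : ℤ) ∣ n := ⟨Multiplicative.toAdd (K u) 0, by simpa using h4.symm⟩
    exact_mod_cast this
  · rintro ⟨m, rfl⟩
    exact ⟨Abelianization.of x ^ m, by rw [← pow_mul, mul_comm]⟩

/-- Sum coefficients over elements with the same content. -/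
noncomputable def phi (r : R) : MonoidAlgebra (ZMod 2) (Set ℕ) := MonoidAlgebra.mapDomain content r

lemma phi_add (r s : R) : phi (r + s) = phi r + phi s := MonoidAlgebra.mapDomain_add _ _ _

lemma phi_A (α : F ≃* F) (r : R) : phi (A α.toMonoidHom r) = phi r := by
  have hc : ∀ v, content (Abelianization.map α.toMonoidHom v) = content v :=
    fun v => content_map α.abelianizationCongr v
  induction r using MonoidAlgebra.induction_linear with
  | zero => simp
  | add f g hf hg => rw [map_add, phi_add, phi_add, hf, hg]
  | single v t =>
    have h1 : A α.toMonoidHom (MonoidAlgebra.single v t) =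
        MonoidAlgebra.single (Abelianization.map α.toMonoidHom v) t :=
      MonoidAlgebra.mapDomain_single
    rw [h1, phi, phi, MonoidAlgebra.mapDomain_single, MonoidAlgebra.mapDomain_single, hc]

lemma phi_pow (n : ℕ) : phi (e x ^ n) = MonoidAlgebra.single {k | k ∣ n} 1 := by
  rw [← content_pow]
  rw [← map_pow]
  simp [phi, e]

lemma caseB (α : F ≃* F)
    (hfix : ∀ z : F, Abelianization.of (α z) = Abelianization.of z → z ∈ commutator F) :
    Infinite (Quot (twistedConj α.toMonoidHom)) := by
  obtain ⟨g, hg⟩ := Jac_unit α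
  let w : ℕ → F := fun n => x ^ n * ⁅x, y⁆ * (x ^ n)⁻¹
  have hw : ∀ n, IsP (w n) (e x ^ n) := fun n => by
    simpa using isP_c.conj (e_comm c_mem) (x ^ n)
  have hwm : ∀ n, w n ∈ commutator F := fun n => Subgroup.Normal.conj_mem inferInstance _ c_mem _
  refine Infinite.of_injective (fun n : ℕ => Quot.mk _ (w (n + 1) * g)) ?_
  intro n m h
  obtain ⟨z, hz⟩ := tc_exact _ h
  change w (n + 1) * g = z * (w (m + 1) * g) * (α z)⁻¹ at hz
  have hV : ∀ n, Abelianization.of (w n) = 1 := fun n => by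
    have := hwm n
    rwa [← Abelianization.ker_of, MonoidHom.mem_ker] at this
  have hzc : z ∈ commutator F := by
    apply hfix
    have h1 := congrArg Abelianization.of hz
    simp only [map_mul, map_inv, hV, one_mul] at h1
    rw [eq_mul_inv_iff_mul_eq, mul_comm] at h1
    exact mul_right_cancel h1
  obtain ⟨p, hp⟩ := exists_isP hzc
  have hαz := map_comm_mem α.toMonoidHom hzc
  have h1 := (((hp.map α.toMonoidHom).conj (e_comm hαz) g))
  have hgz : g * α.toMonoidHom z * g⁻¹ ∈ commutator F :=
    Subgroup.Normal.conj_mem inferInstance _ hαz _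
  have h3 : w (n + 1) * (g * α.toMonoidHom z * g⁻¹) = z * w (m + 1) := by
    change w (n + 1) * (g * α z * g⁻¹) = z * w (m + 1)
    rw [← mul_assoc, ← mul_assoc, hz]
    group
  have h4 := (hw (n + 1)).mul h1 (e_comm (hwm _))
  rw [h3] at h4
  have h5 := h4.unique (hp.mul (hw (m + 1)) (e_comm hzc))
  have h6 : e x ^ (n + 1) + A α.toMonoidHom p = p + e x ^ (m + 1) := by
    linear_combination h5 - A α.toMonoidHom p * hg
  have h7 := congrArg phi h6
  rw [phi_add, phi_add, phi_A, add_comm, phi_pow, phi_pow] at h7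
  have h8 := add_left_cancel h7
  have h9 := MonoidAlgebra.single_left_injective (one_ne_zero) h8
  have h10 : n + 1 ∈ {k | k ∣ n + 1} := dvd_refl _
  have h11 : m + 1 ∈ {k | k ∣ m + 1} := dvd_refl _
  rw [h9] at h10
  rw [← h9] at h11
  have := Nat.dvd_antisymm h10 h11
  omega

/-- Exponent sums. -/
noncomputable def kap (i : Fin 2) (w : F) : ℤ := (Multiplicative.toAdd (K (Abelianization.of w))) i

lemma kap_mul (i : Fin 2) (u v : F) : kap i (u * v) = kap i u + kap i v := by
  simp [kap]

lemma kap_of (i j : Fin 2) : kap i (FreeGroup.of j) = if j = i then 1 else 0 := by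
  rw [kap, K_of]; simp [Finsupp.single_apply]

/-- Linear functional. -/
noncomputable def fn (s : Fin 2 → ℤ) : F →* Multiplicative ℤ :=
  FreeGroup.lift (fun i => Multiplicative.ofAdd (s i))

lemma hom_eq (f : F →* Multiplicative ℤ) (w : F) :
    f w = f x ^ kap 0 w * f y ^ kap 1 w := by
  let g : F →* Multiplicative ℤ := MonoidHom.mk' (fun w => f x ^ kap 0 w * f y ^ kap 1 w) (by
    intro a b
    simp only [kap_mul, zpow_add]
    exact mul_mul_mul_comm _ _ _ _)
  have : f = g := by
    ext j
    fin_cases j <;> simp [g, kap_of, x, y]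
  exact DFunLike.congr_fun this w

lemma caseA (α : F ≃* F) (z : F) (hz : Abelianization.of (α z) = Abelianization.of z)
    (hz' : z ∉ commutator F) : Infinite (Quot (twistedConj α.toMonoidHom)) := by
  let M : Matrix (Fin 2) (Fin 2) ℤ :=
    !![kap 0 (α x) - 1, kap 1 (α x); kap 0 (α y), kap 1 (α y) - 1]
  have kz : ∀ i, kap i (α z) = kap i z := fun i => by rw [kap, hz]; rfl
  have hka : ∀ i, kap i (α z) = kap 0 z * kap i (α x) + kap 1 z * kap i (α y) := fun i => by
    let f : F →* Multiplicative ℤ := MonoidHom.mk' (fun w => Multiplicative.ofAdd (kap i (α w))) (by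
      intro a b; rw [map_mul, kap_mul]; rfl)
    have := congrArg Multiplicative.toAdd (hom_eq f z)
    simpa [f] using this
  have hM : Matrix.det M = 0 := by
    rw [← Matrix.exists_vecMul_eq_zero_iff]
    refine ⟨![kap 0 z, kap 1 z], ?_, ?_⟩
    · intro h0
      apply hz'
      have a0 : kap 0 z = 0 := congrFun h0 0
      have a1 : kap 1 z = 0 := congrFun h0 1
      rw [← Abelianization.ker_of, MonoidHom.mem_ker]
      apply K_inj
      rw [map_one]
      apply Multiplicative.toAdd.injective
      ext i
      fin_cases i
      · exact a0
      · exact a1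
    · have b0 := hka 0
      have b1 := hka 1
      rw [kz] at b0 b1
      ext i
      fin_cases i
      · simp [M, Matrix.vecMul, dotProduct, Fin.sum_univ_two]
        linarith
      · simp [M, Matrix.vecMul, dotProduct, Fin.sum_univ_two]
        linarith
  obtain ⟨s, hs, hMs⟩ := Matrix.exists_mulVec_eq_zero_iff.2 hM
  have e0 := congrFun hMs 0
  have e1 := congrFun hMs 1
  simp [M, Matrix.mulVec, dotProduct, Fin.sum_univ_two] at e0 e1
  have hfx : ∀ w, Multiplicative.toAdd (fn s w) = kap 0 w * s 0 + kap 1 w * s 1 := fun w => by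
    rw [hom_eq]
    simp [fn, x, y]
  have hinv : (fn s).comp α.toMonoidHom = fn s := by
    ext j
    apply Multiplicative.toAdd.injective
    change Multiplicative.toAdd (fn s (α (FreeGroup.of j))) = _
    change _ = Multiplicative.toAdd (fn s (FreeGroup.of j))
    rw [hfx, hfx]
    fin_cases j
    · change kap 0 (α x) * s 0 + kap 1 (α x) * s 1 = _
      simp [kap_of]
      linarith
    · change kap 0 (α y) * s 0 + kap 1 (α y) * s 1 = _
      simp [kap_of]
      linarith
  obtain ⟨j, hj⟩ := Function.ne_iff.1 hs
  refine Infinite.of_injective (fun n : ℕ => Quot.mk _ (FreeGroup.of j ^ n)) ?_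
  intro n m h
  obtain ⟨t, ht⟩ := tc_exact _ h
  have h1 := congrArg (fn s) ht
  have h2 : fn s (α.toMonoidHom t) = fn s t := DFunLike.congr_fun hinv t
  rw [map_mul, map_mul, map_inv, h2, mul_comm (fn s t), mul_inv_cancel_right] at h1
  have h3 := congrArg Multiplicative.toAdd h1
  simp [fn] at h3
  rcases h3 with h3 | h3
  · exact h3
  · exact absurd h3 hj

lemma free_Rinf : RinfinityProperty F := by
  intro α
  by_cases h : ∀ z : F, Abelianization.of (α z) = Abelianization.of z → z ∈ commutator F
  · exact caseB α h
  · push Not at h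
    obtain ⟨z, hz, hz'⟩ := h
    exact caseA α z hz hz'

end P3

theorem Rinfinity_of_product_with_center :
    (∀ (H : Type) [Group H], RinfinityProperty H → Subgroup.center H = ⊥ →
      Subgroup.center (H × Multiplicative ℤ) =
        (⊥ : Subgroup H).prod (⊤ : Subgroup (Multiplicative ℤ)) →
      RinfinityProperty (H × Multiplicative ℤ)) ∧
    (∀ (P₃ : Type) [Group P₃],
      Nonempty (P₃ ≃* FreeGroup (Fin 2) × Multiplicative ℤ) → RinfinityProperty P₃) := by
  refine ⟨fun H _ hH hc _ => P3.part1 hH hc, ?_⟩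
  rintro P _ ⟨e⟩
  exact P3.Rinf_of_equiv e (P3.part1 P3.free_Rinf P3.center_free)
end
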